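/- arXiv:1911.05047 — 4 statements merged into one kernel-verified Lean document; each statement's English description precedes it below -/
import Mathlib

section
/- Riemannian subgradient inequality on a compact embedded submanifold: Let F : ℝ^p → ℝ^q be infinitely differentiable, let M = {x ∈ ℝ^p : F(x) = 0} be nonempty and compact, and suppose the derivative DF(x) : ℝ^p → ℝ^q is surjective for every x ∈ M. Let h : ℝ^p → ℝ be τ-weakly convex (τ ≥ 0). Then there exists a constant c > 0 such that for all x, y ∈ M and every subgradient v of h at x, h(y) ≥ h(x) + ⟨v − P⊥_x v, y − x⟩ − c‖y − x‖², where P⊥_x = DF(x)ᵀ(DF(x)DF(x)ᵀ)⁻¹DF(x) (the orthogonal projection of ℝ^p onto the range of DF(x)ᵀ, which is invertible since DF(x) has full row rank), ⟨·,·⟩ is the Euclidean inner product on ℝ^p, and ‖·‖ the Euclidean norm. -/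
open scoped RealInnerProductSpace

noncomputable section

/-- If `A` is surjective, then `A ∘ Aᵀ` is invertible. -/
theorem ContinuousLinearMap.isUnit_comp_adjoint_of_surjective {E G : Type*} [NormedAddCommGroup E]
    [InnerProductSpace ℝ E] [CompleteSpace E] [NormedAddCommGroup G] [InnerProductSpace ℝ G]
    [FiniteDimensional ℝ G] [CompleteSpace G] (A : E →L[ℝ] G) (hA : Function.Surjective A) :
    IsUnit (A.comp (adjoint A)) := by
  have hinj : Function.Injective (A.comp (adjoint A)) := by
    rw [injective_iff_map_eq_zero]
    intro w hw
    have h1 : adjoint A w = 0 := by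
      rw [← inner_self_eq_zero (𝕜 := ℝ), adjoint_inner_left, ← comp_apply, hw, inner_zero_right]
    obtain ⟨u, rfl⟩ := hA w
    rw [← inner_self_eq_zero (𝕜 := ℝ), ← adjoint_inner_right, h1, inner_zero_right]
  rw [ContinuousLinearMap.isUnit_iff_bijective]
  exact ⟨hinj, LinearMap.surjective_of_injective (f := (A.comp (adjoint A)).toLinearMap) hinj⟩

/-- Second-order Taylor bound for a smooth function on a ball. -/
theorem ContDiff.exists_norm_image_sub_sub_fderiv_le {E G : Type*} [NormedAddCommGroup E]
    [NormedSpace ℝ E] [ProperSpace E] [NormedAddCommGroup G] [NormedSpace ℝ G] {F : E → G}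
    (hF : ContDiff ℝ 2 F) (r : ℝ) :
    ∃ C, 0 ≤ C ∧ ∀ x ∈ Metric.closedBall (0 : E) r, ∀ y ∈ Metric.closedBall (0 : E) r,
      ‖F y - F x - fderiv ℝ F x (y - x)‖ ≤ C * ‖y - x‖ ^ 2 := by
  have hF' : ContDiff ℝ 1 (fderiv ℝ F) := hF.fderiv_right (by norm_num)
  obtain ⟨C, hC⟩ := (isCompact_closedBall (0 : E) r).exists_bound_of_continuousOn
    (hF'.continuous_fderiv one_ne_zero).continuousOn
  refine ⟨max C 0, le_max_right _ _, fun x hx y hy => ?_⟩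
  have hseg : segment ℝ x y ⊆ Metric.closedBall (0 : E) r :=
    (convex_closedBall _ _).segment_subset hx hy
  have hlip : ∀ z ∈ segment ℝ x y, ‖fderiv ℝ F z - fderiv ℝ F x‖ ≤ max C 0 * ‖y - x‖ := by
    intro z hz
    have h1 := (convex_segment x y).norm_image_sub_le_of_norm_fderiv_le (𝕜 := ℝ)
      (fun w _ => hF'.differentiable one_ne_zero w)
      (fun w hw => (hC w (hseg hw)).trans (le_max_left C 0)) (left_mem_segment ℝ x y) hz
    exact h1.trans (mul_le_mul_of_nonneg_left (norm_sub_le_of_mem_segment hz)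
      (le_max_right _ _))
  have h2 := (convex_segment x y).norm_image_sub_le_of_norm_fderiv_le' (𝕜 := ℝ)
    (fun w _ => hF.differentiable two_ne_zero w) hlip (left_mem_segment ℝ x y)
    (right_mem_segment ℝ x y)
  rwa [mul_assoc, ← sq] at h2

/-- Subgradients of a weakly convex function are uniformly bounded over a ball. -/
theorem exists_norm_subgradient_le {E : Type*} [NormedAddCommGroup E] [InnerProductSpace ℝ E]
    [ProperSpace E] {h : E → ℝ} (hh : Continuous h) (τ r : ℝ) :
    ∃ L, 0 ≤ L ∧ ∀ x ∈ Metric.closedBall (0 : E) r, ∀ v : E,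
      (∀ z, h z ≥ h x + ⟪v, z - x⟫ - τ / 2 * ‖z - x‖ ^ 2) → ‖v‖ ≤ L := by
  obtain ⟨B, hB⟩ := (isCompact_closedBall (0 : E) (r + 1)).exists_bound_of_continuousOn
    hh.continuousOn
  refine ⟨max (2 * B + τ / 2) 0, le_max_right _ _, fun x hx v hv => ?_⟩
  rcases eq_or_ne v 0 with rfl | hv0
  · simp
  have hpos : ‖v‖ ≠ 0 := norm_ne_zero_iff.2 hv0
  have hu : ‖‖v‖⁻¹ • v‖ = 1 := by rw [norm_smul, norm_inv, norm_norm, inv_mul_cancel₀ hpos]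
  have hz := hv (x + ‖v‖⁻¹ • v)
  rw [add_sub_cancel_left, hu, inner_smul_right, real_inner_self_eq_norm_sq, sq ‖v‖,
    inv_mul_cancel_left₀ hpos] at hz
  rw [mem_closedBall_zero_iff] at hx
  have h1 := abs_le.1 (hB x (by rw [mem_closedBall_zero_iff]; linarith))
  have h2 := abs_le.1 (hB (x + ‖v‖⁻¹ • v) (by
    rw [mem_closedBall_zero_iff]
    exact (norm_add_le _ _).trans (by rw [hu]; linarith)))
  exact le_max_of_le_left (by linarith [h1.1, h2.2])

/-- Riemannian subgradient inequality on a compact embedded submanifold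
M = {x : F(x) = 0} of Euclidean space, where DF(x) is surjective on M. Here
P⊥_x v = DF(x)ᵀ (DF(x)DF(x)ᵀ)⁻¹ DF(x) v is expressed via adjoints and the ring inverse of the
(invertible) operator DF(x) ∘ DF(x)ᵀ. -/
theorem riemannian_subgradient_inequality_submanifold {p q : ℕ}
    (F : EuclideanSpace ℝ (Fin p) → EuclideanSpace ℝ (Fin q))
    (hF : ContDiff ℝ (⊤ : ℕ∞) F)
    (hne : {x | F x = 0}.Nonempty) (hcpt : IsCompact {x | F x = 0})
    (hsurj : ∀ x ∈ {x | F x = 0}, Function.Surjective (fderiv ℝ F x))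
    (τ : ℝ) (hτ : 0 ≤ τ) (h : EuclideanSpace ℝ (Fin p) → ℝ)
    (hwc : ConvexOn ℝ Set.univ fun x => h x + τ / 2 * ‖x‖ ^ 2) :
    ∃ c > 0, ∀ x ∈ {x | F x = 0}, ∀ y ∈ {x | F x = 0},
      ∀ v : EuclideanSpace ℝ (Fin p),
        (∀ z, h z ≥ h x + ⟪v, z - x⟫ - τ / 2 * ‖z - x‖ ^ 2) →
        h y ≥ h x
          + ⟪v - (ContinuousLinearMap.adjoint (fderiv ℝ F x))
                ((Ring.inverse ((fderiv ℝ F x).comp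
                    (ContinuousLinearMap.adjoint (fderiv ℝ F x)))) ((fderiv ℝ F x) v)),
              y - x⟫
          - c * ‖y - x‖ ^ 2 := by
  have hcont : Continuous h := by
    have h1 : Continuous fun x => h x + τ / 2 * ‖x‖ ^ 2 :=
      continuousOn_univ.1 (hwc.continuousOn isOpen_univ)
    have h2 : h = fun x => (h x + τ / 2 * ‖x‖ ^ 2) - τ / 2 * ‖x‖ ^ 2 := by ext; ring
    rw [h2]
    fun_prop
  obtain ⟨r, hr⟩ := hcpt.isBounded.subset_closedBall 0
  have hF2 : ContDiff ℝ 2 F := contDiff_infty.1 hF 2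
  obtain ⟨C, hC0, hC⟩ := hF2.exists_norm_image_sub_sub_fderiv_le r
  obtain ⟨L, hL0, hL⟩ := exists_norm_subgradient_le hcont τ r
  have hDF : Continuous (fderiv ℝ F) := hF2.continuous_fderiv two_ne_zero
  have hinv : ContinuousOn (fun x => (Ring.inverse ((fderiv ℝ F x).comp
      (ContinuousLinearMap.adjoint (fderiv ℝ F x)))).comp (fderiv ℝ F x)) {x | F x = 0} := by
    refine ContinuousOn.clm_comp (fun x hx => ?_) hDF.continuousOn
    obtain ⟨u, hu⟩ := ContinuousLinearMap.isUnit_comp_adjoint_of_surjective _ (hsurj x hx)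
    have h1 := NormedRing.inverse_continuousAt u
    rw [hu] at h1
    have h2 : Continuous fun x => (fderiv ℝ F x).comp
        (ContinuousLinearMap.adjoint (fderiv ℝ F x)) :=
      hDF.clm_comp (ContinuousLinearMap.adjoint.continuous.comp hDF)
    exact (ContinuousAt.comp (f := fun x => (fderiv ℝ F x).comp
        (ContinuousLinearMap.adjoint (fderiv ℝ F x))) h1 h2.continuousAt).continuousWithinAt
  obtain ⟨K, hK⟩ := hcpt.exists_bound_of_continuousOn hinv
  have hK0 : 0 ≤ K := hne.elim fun x hx => (norm_nonneg _).trans (hK x hx)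
  refine ⟨K * L * C + τ / 2 + 1, by positivity, fun x hx y hy v hv => ?_⟩
  set w := Ring.inverse ((fderiv ℝ F x).comp
    (ContinuousLinearMap.adjoint (fderiv ℝ F x))) (fderiv ℝ F x v) with hw
  have hwn : ‖w‖ ≤ K * L :=
    (ContinuousLinearMap.le_of_opNorm_le _ (hK x hx) v).trans
      (mul_le_mul_of_nonneg_left (hL x (hr hx) v hv) hK0)
  have hT := hC x (hr hx) y (hr hy)
  rw [show F y = 0 from hy, show F x = 0 from hx, sub_zero, zero_sub, norm_neg] at hT
  have hb : |⟪w, fderiv ℝ F x (y - x)⟫| ≤ K * L * (C * ‖y - x‖ ^ 2) :=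
    (abs_real_inner_le_norm _ _).trans (mul_le_mul hwn hT (norm_nonneg _) (by positivity))
  rw [inner_sub_left, ContinuousLinearMap.adjoint_inner_left]
  have hvy := hv y
  nlinarith [(abs_le.1 hb).1, sq_nonneg ‖y - x‖]

end
end

section
/- Let F : ℝ^p → ℝ^q be twice continuously differentiable and let M = {x ∈ ℝ^p : F(x) = 0} be compact. Then there exists a constant C > 0 such that ‖DF(x)(y − x)‖ ≤ C‖y − x‖² for all x, y ∈ M, where DF(x) denotes the Fréchet derivative of F at x and ‖·‖ denotes Euclidean norms on ℝ^p and ℝ^q. -/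
noncomputable section

/-- The first-order Taylor remainder of a `C²` map is quadratic, uniformly over a compact set. -/
theorem ContDiff.exists_norm_sub_sub_fderiv_le_of_isCompact {E G : Type*}
    [NormedAddCommGroup E] [NormedSpace ℝ E] [ProperSpace E]
    [NormedAddCommGroup G] [NormedSpace ℝ G] {f : E → G} (hf : ContDiff ℝ 2 f)
    {s : Set E} (hs : IsCompact s) :
    ∃ C > 0, ∀ x ∈ s, ∀ y ∈ s,
      ‖f y - f x - fderiv ℝ f x (y - x)‖ ≤ C * ‖y - x‖ ^ 2 := by
  obtain ⟨R, hR⟩ := hs.isBounded.subset_closedBall 0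
  have hf' : ContDiff ℝ 1 (fderiv ℝ f) := hf.fderiv_right (by norm_num)
  obtain ⟨K, hK⟩ := hf'.contDiffOn.exists_lipschitzOnWith one_ne_zero
    (convex_closedBall (0 : E) R) (isCompact_closedBall 0 R)
  refine ⟨K + 1, by positivity, fun x hx y hy => ?_⟩
  have hseg : segment ℝ x y ⊆ Metric.closedBall 0 R :=
    (convex_closedBall 0 R).segment_subset (hR hx) (hR hy)
  have hbound : ∀ z ∈ segment ℝ x y, ‖fderiv ℝ f z - fderiv ℝ f x‖ ≤ K * ‖y - x‖ := by
    intro z hz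
    have hzx : ‖z - x‖ ≤ ‖y - x‖ := norm_sub_le_of_mem_segment hz
    exact (hK.norm_sub_le (hseg hz) (hR hx)).trans (by gcongr)
  have h := (convex_segment x y).norm_image_sub_le_of_norm_fderiv_le'
    (fun z _ => hf.differentiable two_ne_zero z) hbound
    (left_mem_segment ℝ x y) (right_mem_segment ℝ x y)
  nlinarith [sq_nonneg ‖y - x‖]

/-- If F is C² and M = {x : F(x) = 0} is compact, then there is C > 0 with
‖DF(x)(y − x)‖ ≤ C‖y − x‖² for all x, y ∈ M. -/
theorem derivative_second_order_on_level_set {p q : ℕ}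
    (F : EuclideanSpace ℝ (Fin p) → EuclideanSpace ℝ (Fin q))
    (hF : ContDiff ℝ 2 F)
    (hcpt : IsCompact {x | F x = 0}) :
    ∃ C > 0, ∀ x ∈ {x | F x = 0}, ∀ y ∈ {x | F x = 0},
      ‖fderiv ℝ F x (y - x)‖ ≤ C * ‖y - x‖ ^ 2 := by
  obtain ⟨C, hC, h⟩ := hF.exists_norm_sub_sub_fderiv_le_of_isCompact hcpt
  refine ⟨C, hC, fun x hx y hy => ?_⟩
  have hx0 : F x = 0 := hx
  have hy0 : F y = 0 := hy
  simpa [hx0, hy0, -map_sub] using h x hx y hy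

end
end

section
/- Haystack model, outlier bound: Fix n, r, m₂ ≥ 1 and let o₁,…,o_{m₂} be independent random vectors in ℝⁿ, each with independent Gaussian coordinates of mean 0 and variance 1/n (i.e., each oᵢ ~ N(0, (1/n)Iₙ)). Define the random variable c_{O,max} = (1/m₂)·sup{ ∑_{i=1}^{m₂} ‖Bᵀoᵢ‖₂ : B ∈ ℝ^{n×r}, ‖B‖_F = 1 }. Then for every c₂ > 0, the probability that c_{O,max} ≤ 1/√n + √(8r/m₂) + c₂/√m₂ is at least 1 − 2·exp(−c₂²n/2). -/
open Matrix MeasureTheory ProbabilityTheory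

noncomputable section

/-- Frobenius norm of a real matrix. -/
def fnorm {n r : ℕ} (A : Matrix (Fin n) (Fin r) ℝ) : ℝ :=
  Real.sqrt ((Aᵀ * A).trace)

/-- Euclidean norm of a vector. -/
def vnorm {k : ℕ} (v : Fin k → ℝ) : ℝ := Real.sqrt (∑ i, v i ^ 2)

/-- Law of a random vector in ℝᵏ with independent N(0, σ²) coordinates. -/
def gaussianVec (k : ℕ) (σ2 : NNReal) : Measure (Fin k → ℝ) :=
  Measure.pi fun _ : Fin k => gaussianReal 0 σ2

open scoped NNReal

section GaussianIntegrationByParts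

/-- The standard Gaussian measure on `ι → ℝ`. -/
abbrev piStdGaussian (ι : Type*) [Fintype ι] : Measure (ι → ℝ) :=
  Measure.pi fun _ : ι => gaussianReal 0 1

lemma integrable_exp_mul_abs_gaussianReal (C : ℝ) :
    Integrable (fun t : ℝ => Real.exp (C * |t|)) (gaussianReal 0 1) :=
  integrable_exp_mul_abs (X := fun t : ℝ => t) (integrable_exp_mul_gaussianReal C)
    (integrable_exp_mul_gaussianReal (-C))

/-- A function of at most exponential growth is integrable for the standard Gaussian measure. -/
lemma integrable_piStdGaussian_of_le_exp {ι : Type*} [Fintype ι] {f : (ι → ℝ) → ℝ}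
    (hf : Continuous f) (A C : ℝ) (hb : ∀ x, |f x| ≤ A * Real.exp (C * ∑ i, |x i|)) :
    Integrable f (piStdGaussian ι) := by
  have h : Integrable (fun x : ι → ℝ => ∏ i, Real.exp (C * |x i|)) (piStdGaussian ι) :=
    Integrable.fintype_prod (f := fun (_ : ι) (t : ℝ) => Real.exp (C * |t|))
      fun _ => integrable_exp_mul_abs_gaussianReal C
  refine (h.const_mul A).mono' hf.aestronglyMeasurable (.of_forall fun x => ?_)
  rw [← Real.exp_sum, ← Finset.mul_sum]
  exact hb x

lemma integrable_gaussianPDFReal_mul {f : ℝ → ℝ} (hf : Integrable f (gaussianReal 0 1)) :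
    Integrable (fun t => gaussianPDFReal 0 1 t * f t) := by
  rw [gaussianReal_of_var_ne_zero _ one_ne_zero,
    integrable_withDensity_iff_integrable_smul' (measurable_gaussianPDF _ _)
      (.of_forall fun _ => gaussianPDF_lt_top)] at hf
  simpa [toReal_gaussianPDF] using hf

lemma hasDerivAt_gaussianPDFReal (t : ℝ) :
    HasDerivAt (gaussianPDFReal 0 1) (-(t * gaussianPDFReal 0 1 t)) t := by
  have h : HasDerivAt (fun t : ℝ => -(t - 0) ^ 2 / (2 * ((1 : ℝ≥0) : ℝ))) (-t) t := by
    have := (((hasDerivAt_id t).sub_const 0).pow 2).neg.div_const (2 * ((1 : ℝ≥0) : ℝ))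
    convert! this using 1
    simp
    ring
  rw [gaussianPDFReal_def]
  convert! h.exp.const_mul _ using 1
  ring

/-- **Gaussian integration by parts** on the line. -/
lemma integral_id_mul_gaussianReal {f f' : ℝ → ℝ} (hf : ∀ t, HasDerivAt f (f' t) t)
    (hf' : Continuous f') (A C : ℝ) (hb : ∀ t, |f t| ≤ A * Real.exp (C * |t|))
    (hb' : ∀ t, |f' t| ≤ A * Real.exp (C * |t|)) :
    ∫ t, t * f t ∂(gaussianReal 0 1) = ∫ t, f' t ∂(gaussianReal 0 1) := by
  have hfc : Continuous f := continuous_iff_continuousAt.2 fun t => (hf t).continuousAt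
  have hint (C : ℝ) {g : ℝ → ℝ} (hg : Continuous g) (hb : ∀ t, |g t| ≤ A * Real.exp (C * |t|)) :
      Integrable (fun t => gaussianPDFReal 0 1 t * g t) :=
    integrable_gaussianPDFReal_mul <|
      ((integrable_exp_mul_abs_gaussianReal C).const_mul A).mono' hg.aestronglyMeasurable
        (.of_forall hb)
  have hbt (t : ℝ) : |t * f t| ≤ A * Real.exp ((C + 1) * |t|) := by
    have h1 : |t| ≤ Real.exp |t| := by linarith [Real.add_one_le_exp |t|]
    rw [abs_mul, add_mul, one_mul, Real.exp_add, mul_comm, ← mul_assoc]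
    exact mul_le_mul (hb t) h1 (abs_nonneg _) ((abs_nonneg _).trans (hb t))
  have key := integral_mul_deriv_eq_deriv_mul_of_integrable (u := f) (u' := f')
    (v := gaussianPDFReal 0 1) (v' := fun t => -(t * gaussianPDFReal 0 1 t))
    (fun t _ => hf t) (fun t _ => hasDerivAt_gaussianPDFReal t)
    ((hint (C + 1) (by fun_prop) hbt).neg.congr (.of_forall fun t => by simp; ring))
    ((hint C hf' hb').congr (.of_forall fun t => by simp; ring))
    ((hint C hfc hb).congr (.of_forall fun t => by simp; ring))
  rw [integral_gaussianReal_eq_integral_smul one_ne_zero,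
    integral_gaussianReal_eq_integral_smul one_ne_zero]
  simp only [mul_neg, integral_neg, neg_inj] at key
  simp only [smul_eq_mul]
  calc ∫ t, gaussianPDFReal 0 1 t * (t * f t) = ∫ t, f t * (t * gaussianPDFReal 0 1 t) := by
        congr with t; ring
    _ = ∫ t, gaussianPDFReal 0 1 t * f' t := by rw [key]; congr with t; ring

/-- Resampling one coordinate preserves a product measure. -/
lemma measurePreserving_update_pi {ι X : Type*} [Fintype ι] [DecidableEq ι] [MeasurableSpace X]
    (μ : Measure X) [IsProbabilityMeasure μ] (i : ι) :
    MeasurePreserving (fun p : (ι → X) × X => Function.update p.1 i p.2)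
      ((Measure.pi fun _ => μ).prod μ) (Measure.pi fun _ => μ) := by
  have hm : Measurable fun p : (ι → X) × X => Function.update p.1 i p.2 :=
    measurable_update'
  refine ⟨hm, (Measure.pi_eq fun s hs => ?_).symm⟩
  rw [Measure.map_apply hm (MeasurableSet.univ_pi hs)]
  have : (fun p : (ι → X) × X => Function.update p.1 i p.2) ⁻¹' Set.univ.pi s =
      (Set.univ.pi (Function.update s i Set.univ)) ×ˢ s i := by
    ext ⟨x, t⟩
    simp only [Set.mem_preimage, Set.mem_univ_pi, Set.mem_prod]
    constructor
    · refine fun h => ⟨fun j => ?_, by simpa using h i⟩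
      rcases eq_or_ne j i with rfl | hj
      · simp
      · simpa [hj] using h j
    · rintro ⟨h, ht⟩ j
      rcases eq_or_ne j i with rfl | hj
      · simpa using ht
      · simpa [hj] using h j
  rw [this, Measure.prod_prod, Measure.pi_pi, ← Finset.prod_erase_mul _ _ (Finset.mem_univ i),
    ← Finset.prod_erase_mul (a := i) _ (fun j => μ (s j)) (Finset.mem_univ i)]
  simp only [Function.update_self, measure_univ, mul_one]
  congr 1
  exact Finset.prod_congr rfl fun j hj => by rw [Function.update_of_ne (Finset.ne_of_mem_erase hj)]

/-- **Gaussian integration by parts** in one coordinate of a standard Gaussian vector. -/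
lemma integral_apply_mul_piStdGaussian {ι : Type*} [Fintype ι] [DecidableEq ι]
    {f f' : (ι → ℝ) → ℝ} (i : ι) (hfc : Continuous f) (hf'c : Continuous f')
    (hf : ∀ x t, HasDerivAt (fun s => f (Function.update x i s)) (f' (Function.update x i t)) t)
    (A C : ℝ) (hC : 0 ≤ C) (hb : ∀ x, |f x| ≤ A * Real.exp (C * ∑ i, |x i|))
    (hb' : ∀ x, |f' x| ≤ A * Real.exp (C * ∑ i, |x i|)) :
    Integrable (fun x => x i * f x) (piStdGaussian ι) ∧ Integrable f' (piStdGaussian ι) ∧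
      ∫ x, x i * f x ∂(piStdGaussian ι) = ∫ x, f' x ∂(piStdGaussian ι) := by
  have hA : 0 ≤ A := by simpa using (abs_nonneg _).trans (hb 0)
  have hmp : MeasurePreserving (fun p : (ι → ℝ) × ℝ => Function.update p.1 i p.2)
      ((piStdGaussian ι).prod (gaussianReal 0 1)) (piStdGaussian ι) :=
    measurePreserving_update_pi (gaussianReal 0 1) i
  have hsum (x : ι → ℝ) (t : ℝ) :
      A * Real.exp (C * ∑ j, |Function.update x i t j|) ≤
        (A * Real.exp (C * ∑ j, |x j|)) * Real.exp (C * |t|) := by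
    rw [mul_assoc, ← Real.exp_add, ← mul_add]
    gcongr
    rw [← Finset.sum_erase_add _ _ (Finset.mem_univ i), Function.update_self]
    gcongr
    rw [← Finset.sum_erase_add _ (fun j => |x j|) (Finset.mem_univ i)]
    refine le_add_of_le_of_nonneg (Finset.sum_le_sum fun j hj => ?_) (abs_nonneg _)
    rw [Function.update_of_ne (Finset.ne_of_mem_erase hj)]
  have hi1 : Integrable (fun x => x i * f x) (piStdGaussian ι) := by
    refine integrable_piStdGaussian_of_le_exp (by fun_prop) A (C + 1) fun x => ?_
    have h1 : |x i| ≤ Real.exp (∑ j, |x j|) := by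
      have := Finset.single_le_sum (f := fun j => |x j|) (fun j _ => abs_nonneg _)
        (Finset.mem_univ i)
      linarith [Real.add_one_le_exp (∑ j, |x j|)]
    rw [abs_mul, add_mul, one_mul, Real.exp_add, mul_comm, ← mul_assoc]
    exact mul_le_mul (hb x) h1 (abs_nonneg _) (by positivity)
  have hi2 : Integrable f' (piStdGaussian ι) :=
    integrable_piStdGaussian_of_le_exp hf'c A C hb'
  have fubini {g : (ι → ℝ) → ℝ} (hg : Integrable g (piStdGaussian ι)) :
      ∫ x, g x ∂(piStdGaussian ι) =
        ∫ x, ∫ t, g (Function.update x i t) ∂(gaussianReal 0 1) ∂(piStdGaussian ι) := by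
    have h := integral_map hmp.aemeasurable (f := g) (by rw [hmp.map_eq]; exact hg.1)
    rw [hmp.map_eq] at h
    rw [h]
    exact integral_prod _ (hmp.integrable_comp_of_integrable hg)
  refine ⟨hi1, hi2, ?_⟩
  rw [fubini hi1, fubini hi2]
  congr with x
  simp only [Function.update_self]
  exact integral_id_mul_gaussianReal (hf x) (by fun_prop) _ C
    (fun t => (hb _).trans (hsum x t)) (fun t => (hb' _).trans (hsum x t))

end GaussianIntegrationByParts

section Slepian

variable {ι K : Type*} [Fintype ι]

/-- The exponentials of the linear forms on `ι → ℝ` whose coefficients are the columns of `a`. -/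
def expLin (a : ι → K → ℝ) (x : ι → ℝ) (k : K) : ℝ := Real.exp (∑ i, a i k * x i)

lemma expLin_pos (a : ι → K → ℝ) (x : ι → ℝ) (k : K) : 0 < expLin a x k := Real.exp_pos _

@[fun_prop]
lemma continuous_expLin (a : ι → K → ℝ) (k : K) : Continuous fun x => expLin a x k := by
  unfold expLin
  fun_prop

lemma exists_forall_abs_le {α β : Type*} [Finite α] [Finite β] (a : α → β → ℝ) :
    ∃ M, 0 ≤ M ∧ ∀ i k, |a i k| ≤ M := by
  obtain ⟨M, hM⟩ := (Set.finite_range fun q : α × β => |a q.1 q.2|).bddAbove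
  exact ⟨max M 0, le_max_right _ _, fun i k => (hM ⟨(i, k), rfl⟩).trans (le_max_left _ _)⟩

lemma expLin_le {a : ι → K → ℝ} {M : ℝ} (ha : ∀ i k, |a i k| ≤ M) (x : ι → ℝ) (k : K) :
    expLin a x k ≤ Real.exp (M * ∑ i, |x i|) := by
  refine Real.exp_le_exp.2 ?_
  rw [Finset.mul_sum]
  refine Finset.sum_le_sum fun i _ => (le_abs_self _).trans ?_
  rw [abs_mul]
  exact mul_le_mul_of_nonneg_right (ha i k) (abs_nonneg _)

lemma hasDerivAt_expLin_update [DecidableEq ι] (a : ι → K → ℝ) (k : K) (i : ι) (x : ι → ℝ)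
    (t : ℝ) :
    HasDerivAt (fun s => expLin a (Function.update x i s) k)
      (a i k * expLin a (Function.update x i t) k) t := by
  have h : HasDerivAt (fun s => ∑ j, a j k * Function.update x i s j) (a i k) t := by
    have := HasDerivAt.fun_sum (u := Finset.univ)
      (A := fun j s => a j k * Function.update x i s j)
      (A' := fun j => if j = i then a i k else 0) (x := t) fun j _ => by
        rcases eq_or_ne j i with rfl | hj
        · simpa using (hasDerivAt_id t).const_mul (a j k)
        · simpa [hj] using hasDerivAt_const t _
    simpa using this
  unfold expLin
  convert! h.exp using 1
  ring

variable [Fintype K]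

/-- The sum of the exponentials of the linear forms with coefficients `a`. -/
def sumExpLin (a : ι → K → ℝ) (x : ι → ℝ) : ℝ := ∑ k, expLin a x k

@[fun_prop]
lemma continuous_sumExpLin (a : ι → K → ℝ) : Continuous (sumExpLin a) := by
  unfold sumExpLin
  fun_prop

lemma expLin_le_sumExpLin (a : ι → K → ℝ) (x : ι → ℝ) (k : K) : expLin a x k ≤ sumExpLin a x :=
  Finset.single_le_sum (f := expLin a x) (fun j _ => (expLin_pos a x j).le) (Finset.mem_univ k)

lemma hasDerivAt_sumExpLin_update [DecidableEq ι] (a : ι → K → ℝ) (i : ι) (x : ι → ℝ) (t : ℝ) :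
    HasDerivAt (fun s => sumExpLin a (Function.update x i s))
      (∑ k, a i k * expLin a (Function.update x i t) k) t :=
  HasDerivAt.fun_sum fun k _ => hasDerivAt_expLin_update a k i x t

lemma abs_sum_mul_expLin_le {b : K → ℝ} {M : ℝ} (hb : ∀ k, |b k| ≤ M) (a : ι → K → ℝ)
    (x : ι → ℝ) : |∑ k, b k * expLin a x k| ≤ M * sumExpLin a x := by
  rw [sumExpLin, Finset.mul_sum]
  refine (Finset.abs_sum_le_sum_abs _ _).trans (Finset.sum_le_sum fun k _ => ?_)
  rw [abs_mul, abs_of_pos (expLin_pos a x k)]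
  exact mul_le_mul_of_nonneg_right (hb k) (expLin_pos a x k).le

variable [Nonempty K]

lemma sumExpLin_pos (a : ι → K → ℝ) (x : ι → ℝ) : 0 < sumExpLin a x :=
  Finset.sum_pos (fun k _ => expLin_pos a x k) Finset.univ_nonempty

@[fun_prop]
lemma continuous_sumExpLin_rpow (a : ι → K → ℝ) (q : ℝ) :
    Continuous fun x => sumExpLin a x ^ q :=
  (continuous_sumExpLin a).rpow_const fun x => .inl (sumExpLin_pos a x).ne'

lemma sumExpLin_rpow_le {a : ι → K → ℝ} {M p : ℝ} (ha : ∀ i k, |a i k| ≤ M) (hM : 0 ≤ M)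
    (hp : 0 ≤ p) (hp1 : p ≤ 1) (x : ι → ℝ) :
    sumExpLin a x ^ p ≤ (1 + Fintype.card K) * Real.exp (M * ∑ i, |x i|) := by
  have hS := sumExpLin_pos a x
  have h1 : sumExpLin a x ^ p ≤ 1 + sumExpLin a x := by
    calc sumExpLin a x ^ p ≤ (1 + sumExpLin a x) ^ p := by gcongr; linarith
      _ ≤ (1 + sumExpLin a x) ^ (1 : ℝ) := Real.rpow_le_rpow_of_exponent_le (by linarith) hp1
      _ = _ := Real.rpow_one _
  have h2 : sumExpLin a x ≤ Fintype.card K * Real.exp (M * ∑ i, |x i|) := by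
    have := Finset.sum_le_card_nsmul Finset.univ (expLin a x) _ fun k _ => expLin_le ha x k
    simpa [sumExpLin] using this
  have h3 : 1 ≤ Real.exp (M * ∑ i, |x i|) :=
    Real.one_le_exp (mul_nonneg hM (Finset.sum_nonneg fun i _ => abs_nonneg _))
  linarith

lemma expLin_mul_rpow_le (a : ι → K → ℝ) (p : ℝ) (x : ι → ℝ) (k : K) :
    expLin a x k * sumExpLin a x ^ (p - 1) ≤ sumExpLin a x ^ p := by
  have hS := sumExpLin_pos a x
  calc _ ≤ sumExpLin a x * sumExpLin a x ^ (p - 1) := by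
        gcongr; exact expLin_le_sumExpLin a x k
    _ = _ := by rw [Real.rpow_sub_one hS.ne']; field_simp

lemma integrable_sumExpLin_rpow (a : ι → K → ℝ) {p : ℝ} (hp : 0 ≤ p) (hp1 : p ≤ 1) :
    Integrable (fun x => sumExpLin a x ^ p) (piStdGaussian ι) := by
  obtain ⟨M, hM, ha⟩ := exists_forall_abs_le a
  refine integrable_piStdGaussian_of_le_exp (by fun_prop) (1 + Fintype.card K) M fun x => ?_
  rw [abs_of_pos (Real.rpow_pos_of_pos (sumExpLin_pos a x) p)]
  exact sumExpLin_rpow_le ha hM hp hp1 x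

/-- Gaussian integration by parts for the partial derivatives of `(∑ exp) ^ p`. -/
lemma integral_apply_mul_expLin_mul_rpow (a : ι → K → ℝ) {p : ℝ} (hp : 0 ≤ p) (hp1 : p ≤ 1)
    (i : ι) (k : K) :
    let g := fun x => a i k * expLin a x k * sumExpLin a x ^ (p - 1) +
      expLin a x k * ((∑ j, a i j * expLin a x j) * (p - 1) * sumExpLin a x ^ (p - 1 - 1))
    Integrable (fun x => x i * (expLin a x k * sumExpLin a x ^ (p - 1))) (piStdGaussian ι) ∧
      Integrable g (piStdGaussian ι) ∧
      ∫ x, x i * (expLin a x k * sumExpLin a x ^ (p - 1)) ∂(piStdGaussian ι) =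
        ∫ x, g x ∂(piStdGaussian ι) := by
  classical
  obtain ⟨M, hM0, ha⟩ := exists_forall_abs_le a
  set B : ℝ := 1 + Fintype.card K
  have hB : 0 ≤ B := by positivity
  have hle (x : ι → ℝ) : sumExpLin a x ^ p ≤ B * Real.exp (M * ∑ i, |x i|) :=
    sumExpLin_rpow_le ha hM0 hp hp1 x
  refine integral_apply_mul_piStdGaussian i (by fun_prop) (by fun_prop) (fun x t => ?_)
    ((1 + 2 * M) * B) M hM0 (fun x => ?_) (fun x => ?_)
  · exact (hasDerivAt_expLin_update a k i x t).mul
      ((hasDerivAt_sumExpLin_update a i x t).rpow_const (.inl (sumExpLin_pos a _).ne'))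
  · have hS := sumExpLin_pos a x
    rw [abs_of_pos (mul_pos (expLin_pos a x k) (Real.rpow_pos_of_pos hS _))]
    refine (expLin_mul_rpow_le a p x k).trans ((hle x).trans ?_)
    gcongr
    nlinarith
  · have hS := sumExpLin_pos a x
    have hE := expLin_pos a x k
    have h1 : |a i k * expLin a x k * sumExpLin a x ^ (p - 1)| ≤ M * sumExpLin a x ^ p := by
      rw [mul_assoc, abs_mul, abs_of_pos (mul_pos hE (Real.rpow_pos_of_pos hS _))]
      exact mul_le_mul (ha i k) (expLin_mul_rpow_le a p x k) (by positivity) hM0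
    have h2 : |expLin a x k * ((∑ j, a i j * expLin a x j) * (p - 1) *
        sumExpLin a x ^ (p - 1 - 1))| ≤ M * sumExpLin a x ^ p := by
      rw [abs_mul, abs_mul, abs_mul, abs_of_pos hE, abs_of_pos (Real.rpow_pos_of_pos hS _)]
      calc _ ≤ expLin a x k * (M * sumExpLin a x * 1 * sumExpLin a x ^ (p - 1 - 1)) := by
            gcongr
            · exact abs_sum_mul_expLin_le (ha i) a x
            · rw [abs_le]; constructor <;> linarith
        _ = M * (expLin a x k * sumExpLin a x ^ (p - 1)) := by
            rw [Real.rpow_sub_one hS.ne' (p - 1)]; field_simp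
        _ ≤ _ := by gcongr; exact expLin_mul_rpow_le a p x k
    calc _ ≤ M * sumExpLin a x ^ p + M * sumExpLin a x ^ p :=
          (abs_add_le _ _).trans (add_le_add h1 h2)
      _ = 2 * M * sumExpLin a x ^ p := by ring
      _ ≤ (1 + 2 * M) * (B * Real.exp (M * ∑ i, |x i|)) := by
          gcongr
          · linarith
          · exact hle x
      _ = _ := by ring

lemma hasDerivAt_integral_sumExpLin_rpow (c : ι → K → ℝ) {p : ℝ} (hp : 0 ≤ p) (hp1 : p ≤ 1)
    {s s' : ℝ → ι → ℝ} (hs : ∀ i θ, HasDerivAt (fun u => s u i) (s' θ i) θ)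
    (hs1 : ∀ θ i, |s θ i| ≤ 1) (hs1' : ∀ θ i, |s' θ i| ≤ 1) (θ : ℝ) :
    HasDerivAt (fun u => ∫ x, sumExpLin (fun i k => s u i * c i k) x ^ p ∂(piStdGaussian ι))
      (∫ x, (∑ k, (∑ i, s' θ i * c i k * x i) * expLin (fun i k => s θ i * c i k) x k) * p *
        sumExpLin (fun i k => s θ i * c i k) x ^ (p - 1) ∂(piStdGaussian ι)) θ := by
  obtain ⟨M, hM0, hc⟩ := exists_forall_abs_le c
  have ha (θ i k) : |s θ i * c i k| ≤ M := by
    rw [abs_mul]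
    exact (mul_le_mul (hs1 θ i) (hc i k) (abs_nonneg _) zero_le_one).trans_eq (one_mul M)
  have ha' (θ i k) : |s' θ i * c i k| ≤ M := by
    rw [abs_mul]
    exact (mul_le_mul (hs1' θ i) (hc i k) (abs_nonneg _) zero_le_one).trans_eq (one_mul M)
  set B : ℝ := 1 + Fintype.card K
  have hbound : Integrable (fun x : ι → ℝ => B * Real.exp (2 * M * ∑ i, |x i|))
      (piStdGaussian ι) :=
    integrable_piStdGaussian_of_le_exp (by fun_prop) B (2 * M) fun x => by
      rw [abs_of_nonneg (by positivity)]
  refine (hasDerivAt_integral_of_dominated_loc_of_deriv_le (s := Set.univ) Filter.univ_mem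
    (.of_forall fun u => (by fun_prop : Continuous _).aestronglyMeasurable)
    (integrable_sumExpLin_rpow _ hp hp1)
    (F' := fun u x => (∑ k, (∑ i, s' u i * c i k * x i) *
      expLin (fun i k => s u i * c i k) x k) * p * sumExpLin (fun i k => s u i * c i k) x ^ (p - 1))
    (by fun_prop : Continuous _).aestronglyMeasurable
    (.of_forall fun x u _ => ?_) hbound (.of_forall fun x u _ => ?_)).2
  · set a : ι → K → ℝ := fun i k => s u i * c i k
    have hS := sumExpLin_pos a x
    set T := ∑ i, |x i|
    have hT : 0 ≤ T := Finset.sum_nonneg fun i _ => abs_nonneg _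
    have h1 (k) : |∑ i, s' u i * c i k * x i| ≤ M * T := by
      rw [Finset.mul_sum]
      refine (Finset.abs_sum_le_sum_abs _ _).trans (Finset.sum_le_sum fun i _ => ?_)
      rw [abs_mul]
      exact mul_le_mul_of_nonneg_right (ha' u i k) (abs_nonneg _)
    rw [Real.norm_eq_abs, abs_mul, abs_mul, abs_of_nonneg hp,
      abs_of_pos (Real.rpow_pos_of_pos hS _)]
    calc _ ≤ M * T * sumExpLin a x * 1 * sumExpLin a x ^ (p - 1) := by
          gcongr
          exact abs_sum_mul_expLin_le h1 a x
      _ = M * T * sumExpLin a x ^ p := by rw [Real.rpow_sub_one hS.ne']; field_simp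
      _ ≤ Real.exp (M * T) * (B * Real.exp (M * T)) := by
          gcongr
          · linarith [Real.add_one_le_exp (M * T)]
          · exact sumExpLin_rpow_le (ha u) hM0 hp hp1 x
      _ = _ := by rw [mul_assoc 2, two_mul, Real.exp_add]; ring
  · refine HasDerivAt.rpow_const (HasDerivAt.fun_sum fun k _ => ?_)
      (.inl (sumExpLin_pos _ x).ne')
    have h : HasDerivAt (fun u => ∑ i, s u i * c i k * x i) (∑ i, s' u i * c i k * x i) u :=
      HasDerivAt.fun_sum fun i _ => ((hs i u).mul_const _).mul_const _
    unfold expLin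
    convert! h.exp using 1
    ring

/-- The derivative of the integral of `(∑ exp) ^ p` along a rescaling of the coordinates,
expressed through the derivative of the covariance matrix. -/
lemma integral_deriv_sumExpLin_rpow (c : ι → K → ℝ) {p : ℝ} (hp : 0 ≤ p) (hp1 : p ≤ 1)
    (s s' : ι → ℝ) :
    let D : K → K → ℝ := fun j k => ∑ i, s' i * s i * c i j * c i k
    let a : ι → K → ℝ := fun i k => s i * c i k
    let g := fun x => p * ((∑ k, D k k * expLin a x k) * sumExpLin a x ^ (p - 1) +
      (p - 1) * (∑ k, ∑ j, D j k * expLin a x j * expLin a x k) * sumExpLin a x ^ (p - 1 - 1))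
    Integrable g (piStdGaussian ι) ∧
      ∫ x, (∑ k, (∑ i, s' i * c i k * x i) * expLin a x k) * p * sumExpLin a x ^ (p - 1)
        ∂(piStdGaussian ι) = ∫ x, g x ∂(piStdGaussian ι) := by
  intro D a G
  have ibp := integral_apply_mul_expLin_mul_rpow a hp hp1
  set g : ι → K → (ι → ℝ) → ℝ := fun i k x => a i k * expLin a x k * sumExpLin a x ^ (p - 1) +
      expLin a x k * ((∑ j, a i j * expLin a x j) * (p - 1) * sumExpLin a x ^ (p - 1 - 1)) with hg
  have hG : (fun x => ∑ k, ∑ i, p * (s' i * c i k) * g i k x) = G := by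
    ext x
    simp only [hg, G, D, mul_add, Finset.sum_add_distrib, Finset.sum_mul, Finset.mul_sum]
    congr 1
    · refine Finset.sum_congr rfl fun k _ => Finset.sum_congr rfl fun i _ => ?_
      simp only [a]
      ring
    · refine Finset.sum_congr rfl fun k _ => ?_
      rw [Finset.sum_comm]
      refine Finset.sum_congr rfl fun j _ => Finset.sum_congr rfl fun i _ => ?_
      simp only [a]
      ring
  have hint : Integrable (fun x => ∑ k, ∑ i, p * (s' i * c i k) * g i k x) (piStdGaussian ι) :=
    integrable_finsetSum _ fun k _ => integrable_finsetSum _ fun i _ => (ibp i k).2.1.const_mul _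
  refine ⟨hG ▸ hint, ?_⟩
  calc _ = ∫ x, ∑ k, ∑ i, p * (s' i * c i k) *
        (x i * (expLin a x k * sumExpLin a x ^ (p - 1))) ∂(piStdGaussian ι) := by
        congr with x
        simp only [Finset.sum_mul]
        refine Finset.sum_congr rfl fun k _ => Finset.sum_congr rfl fun i _ => by ring
    _ = ∑ k, ∑ i, p * (s' i * c i k) *
        ∫ x, (x i * (expLin a x k * sumExpLin a x ^ (p - 1))) ∂(piStdGaussian ι) := by
        rw [integral_finsetSum _ fun k _ => integrable_finsetSum _ fun i _ =>
          (ibp i k).1.const_mul _]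
        refine Finset.sum_congr rfl fun k _ => ?_
        rw [integral_finsetSum _ fun i _ => (ibp i k).1.const_mul _]
        simp only [integral_const_mul]
    _ = ∑ k, ∑ i, p * (s' i * c i k) * ∫ x, g i k x ∂(piStdGaussian ι) := by
        simp only [fun i k => (ibp i k).2.2, hg]
    _ = ∫ x, ∑ k, ∑ i, p * (s' i * c i k) * g i k x ∂(piStdGaussian ι) := by
        rw [integral_finsetSum _ fun k _ => integrable_finsetSum _ fun i _ =>
          (ibp i k).2.1.const_mul _]
        refine Finset.sum_congr rfl fun k _ => ?_
        rw [integral_finsetSum _ fun i _ => (ibp i k).2.1.const_mul _]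
        exact Finset.sum_congr rfl fun i _ => (integral_const_mul _ _).symm
    _ = _ := by rw [hG]

/-- **The Slepian comparison inequality** for `(∑ exp) ^ p`. The constant `κ` accounts for an
additional independent Gaussian of variance `κ` common to all the `z`-forms. -/
lemma exp_mul_integral_sumExpLin_rpow_le {α β : Type*} [Fintype α] [Fintype β]
    (z : α → K → ℝ) (y : β → K → ℝ) {p κ : ℝ} (hp : 0 ≤ p) (hp1 : p ≤ 1)
    (hdiag : ∀ k, ∑ i, z i k ^ 2 + κ = ∑ i, y i k ^ 2)
    (hcov : ∀ j k, ∑ i, y i j * y i k ≤ ∑ i, z i j * z i k + κ) :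
    Real.exp (p ^ 2 * κ / 2) *
        ∫ x, sumExpLin (Sum.elim z 0) x ^ p ∂(piStdGaussian (α ⊕ β)) ≤
      ∫ x, sumExpLin (Sum.elim 0 y) x ^ p ∂(piStdGaussian (α ⊕ β)) := by
  let c : α ⊕ β → K → ℝ := Sum.elim z y
  let s : ℝ → α ⊕ β → ℝ := fun θ => Sum.elim (fun _ => Real.sin θ) (fun _ => Real.cos θ)
  let s' : ℝ → α ⊕ β → ℝ := fun θ => Sum.elim (fun _ => Real.cos θ) (fun _ => -Real.sin θ)
  let H : ℝ → ℝ := fun θ => ∫ x, sumExpLin (fun i k => s θ i * c i k) x ^ p ∂(piStdGaussian _)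
  have hs (i θ) : HasDerivAt (fun u => s u i) (s' θ i) θ := by
    rcases i with i | i
    exacts [Real.hasDerivAt_sin θ, Real.hasDerivAt_cos θ]
  have hs1 (θ i) : |s θ i| ≤ 1 := by
    rcases i with i | i
    exacts [Real.abs_sin_le_one θ, Real.abs_cos_le_one θ]
  have hs1' (θ i) : |s' θ i| ≤ 1 := by
    rcases i with i | i
    · exact Real.abs_cos_le_one θ
    · simpa [s'] using Real.abs_sin_le_one θ
  have hH (θ) := hasDerivAt_integral_sumExpLin_rpow c hp hp1 hs hs1 hs1' θ
  let E : K → K → ℝ := fun j k => ∑ i, z i j * z i k + κ - ∑ i, y i j * y i k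
  have hE (j k) : 0 ≤ E j k := sub_nonneg.2 (hcov j k)
  have hEd (k) : E k k = 0 := by simpa [E, sub_eq_zero, ← sq] using hdiag k
  let H' : ℝ → ℝ := fun θ => ∫ x, (∑ k, (∑ i, s' θ i * c i k * x i) *
    expLin (fun i k => s θ i * c i k) x k) * p *
    sumExpLin (fun i k => s θ i * c i k) x ^ (p - 1) ∂(piStdGaussian _)
  have hH' {θ : ℝ} (hθ : 0 ≤ Real.sin θ * Real.cos θ) :
      H' θ ≤ -(p ^ 2 * (Real.sin θ * Real.cos θ) * κ) * H θ := by
    set σ := Real.sin θ * Real.cos θ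
    have hD (j k) : σ * (E j k - κ) = ∑ i, s' θ i * s θ i * c i j * c i k := by
      simp only [E, s', s, c, σ, Fintype.sum_sum_type, Sum.elim_inl, Sum.elim_inr, mul_assoc,
        ← Finset.mul_sum]
      ring
    obtain ⟨hint, heq⟩ := integral_deriv_sumExpLin_rpow c hp hp1 (s θ) (s' θ)
    simp only [← hD] at hint heq
    simp only [H', H, heq]
    rw [← integral_const_mul]
    refine integral_mono hint ((integrable_sumExpLin_rpow _ hp hp1).const_mul _) fun x => ?_
    set a : α ⊕ β → K → ℝ := fun i k => s θ i * c i k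
    have hS := sumExpLin_pos a x
    have hQ : 0 ≤ ∑ k, ∑ j, E j k * expLin a x j * expLin a x k :=
      Finset.sum_nonneg fun k _ => Finset.sum_nonneg fun j _ =>
        mul_nonneg (mul_nonneg (hE j k) (expLin_pos a x j).le) (expLin_pos a x k).le
    have h1 : ∑ k, σ * (E k k - κ) * expLin a x k = -(σ * κ) * sumExpLin a x := by
      simp only [hEd, sumExpLin, Finset.mul_sum]
      exact Finset.sum_congr rfl fun k _ => by ring
    have h2 : ∑ k, ∑ j, σ * (E j k - κ) * expLin a x j * expLin a x k =
        σ * (∑ k, ∑ j, E j k * expLin a x j * expLin a x k) - σ * κ * sumExpLin a x ^ 2 := by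
      have hsq : sumExpLin a x ^ 2 = ∑ k, ∑ j, expLin a x j * expLin a x k := by
        rw [sq, sumExpLin, Finset.sum_mul_sum, Finset.sum_comm]
      simp only [hsq, Finset.mul_sum, ← Finset.sum_sub_distrib]
      exact Finset.sum_congr rfl fun k _ => Finset.sum_congr rfl fun j _ => by ring
    simp only [h1, h2]
    rw [Real.rpow_sub_one hS.ne' (p - 1), Real.rpow_sub_one hS.ne' p]
    set S := sumExpLin a x
    set Q := ∑ k, ∑ j, E j k * expLin a x j * expLin a x k
    have hSp := Real.rpow_pos_of_pos hS p
    have hrem : 0 ≤ p * (1 - p) * (σ * Q) * (S ^ p / S / S) :=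
      mul_nonneg (mul_nonneg (mul_nonneg hp (sub_nonneg.2 hp1)) (mul_nonneg hθ hQ))
        (by positivity)
    have hid : p * (-(σ * κ) * S * (S ^ p / S) + (p - 1) * (σ * Q - σ * κ * S ^ 2) *
        (S ^ p / S / S)) = -(p ^ 2 * σ * κ) * S ^ p - p * (1 - p) * (σ * Q) * (S ^ p / S / S) := by
      field_simp
      ring
    linarith
  have hanti : AntitoneOn (fun θ => Real.exp (p ^ 2 * κ * Real.sin θ ^ 2 / 2) * H θ)
      (Set.Icc 0 (Real.pi / 2)) := by
    have hder (θ : ℝ) : HasDerivAt (fun θ => Real.exp (p ^ 2 * κ * Real.sin θ ^ 2 / 2) * H θ)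
        (Real.exp (p ^ 2 * κ * Real.sin θ ^ 2 / 2) *
          (p ^ 2 * (Real.sin θ * Real.cos θ) * κ) * H θ +
          Real.exp (p ^ 2 * κ * Real.sin θ ^ 2 / 2) * H' θ) θ := by
      refine HasDerivAt.mul (HasDerivAt.exp ?_) (hH θ)
      convert! ((((Real.hasDerivAt_sin θ).pow 2).const_mul (p ^ 2 * κ)).div_const 2) using 1
      simp
      ring
    refine antitoneOn_of_deriv_nonpos (convex_Icc _ _)
      (fun θ _ => (hder θ).continuousAt.continuousWithinAt)
      (fun θ _ => (hder θ).differentiableAt.differentiableWithinAt) fun θ hθ => ?_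
    rw [interior_Icc] at hθ
    rw [(hder θ).deriv, mul_assoc, ← mul_add]
    refine mul_nonpos_of_nonneg_of_nonpos (Real.exp_pos _).le ?_
    have := hH' (mul_nonneg (Real.sin_nonneg_of_nonneg_of_le_pi hθ.1.le
      (by linarith [hθ.2, Real.pi_pos])) (Real.cos_nonneg_of_neg_pi_div_two_le_of_le
      (by linarith [hθ.1, Real.pi_pos]) hθ.2.le))
    linarith
  have h := hanti (Set.left_mem_Icc.2 (by positivity)) (Set.right_mem_Icc.2 (by positivity))
    (by positivity : (0 : ℝ) ≤ Real.pi / 2)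
  have h0 : (fun i k => s 0 i * c i k) = Sum.elim (0 : α → K → ℝ) y := by
    ext (i | i) k <;> simp [s, c]
  have h1 : (fun i k => s (Real.pi / 2) i * c i k) = Sum.elim z (0 : β → K → ℝ) := by
    ext (i | i) k <;> simp [s, c]
  simpa [H, h0, h1] using h

end Slepian

section OperatorNorm

lemma integrable_exp_mul_sq_gaussianReal {a : ℝ} (ha : a < 1 / 2) :
    Integrable (fun t : ℝ => Real.exp (a * t ^ 2)) (gaussianReal 0 1) ∧
      ∫ t, Real.exp (a * t ^ 2) ∂(gaussianReal 0 1) = (√(1 - 2 * a))⁻¹ := by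
  have hpdf (t : ℝ) : gaussianPDFReal 0 1 t * Real.exp (a * t ^ 2) =
      (√(2 * Real.pi))⁻¹ * Real.exp (-(1 / 2 - a) * t ^ 2) := by
    rw [gaussianPDFReal_def]
    simp only [NNReal.coe_one, mul_one, sub_zero]
    rw [mul_assoc, ← Real.exp_add]
    ring_nf
  constructor
  · rw [gaussianReal_of_var_ne_zero _ one_ne_zero,
      integrable_withDensity_iff_integrable_smul' (measurable_gaussianPDF _ _)
        (.of_forall fun _ => gaussianPDF_lt_top)]
    simp only [toReal_gaussianPDF, smul_eq_mul, hpdf]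
    exact (integrable_exp_neg_mul_sq (by linarith)).const_mul _
  · rw [integral_gaussianReal_eq_integral_smul one_ne_zero]
    simp only [smul_eq_mul, hpdf]
    rw [integral_const_mul, integral_gaussian, ← Real.sqrt_inv, ← Real.sqrt_mul (by positivity),
      ← Real.sqrt_inv]
    congr 1
    have : 1 - 2 * a ≠ 0 := by linarith
    have : 1 / 2 - a ≠ 0 := by linarith
    field_simp

lemma integral_exp_mul_sq_gaussianReal_le {q l : ℝ} (hq : 0 < q) (hl : 0 ≤ l) :
    ∫ t, Real.exp (l / (2 * (q + l)) * t ^ 2) ∂(gaussianReal 0 1) ≤ Real.exp (l / (2 * q)) := by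
  have hql : 0 < q + l := by linarith
  have h : 1 - 2 * (l / (2 * (q + l))) = (1 + l / q)⁻¹ := by
    field_simp
    ring
  rw [(integrable_exp_mul_sq_gaussianReal (by rw [div_lt_div_iff₀] <;> linarith)).2, h,
    Real.sqrt_inv, inv_inv, show l / (2 * q) = l / q / 2 by field_simp, Real.exp_half]
  exact Real.sqrt_le_sqrt (by linarith [Real.add_one_le_exp (l / q)])

lemma sum_mul_le_of_sum_sq_eq_one {M : Type*} [Fintype M] {u : M → ℝ} (hu : ∑ i, u i ^ 2 = 1)
    (g : M → ℝ) {τ : ℝ} (hτ : 0 < τ) : ∑ i, u i * g i ≤ (∑ i, g i ^ 2) / (2 * τ) + τ / 2 := by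
  have h : ∑ i, u i * g i ≤ ∑ i, (g i ^ 2 / (2 * τ) + τ / 2 * u i ^ 2) := by
    refine Finset.sum_le_sum fun i _ => ?_
    have : 0 ≤ (g i - τ * u i) ^ 2 / (2 * τ) := by positivity
    have h2 : (g i - τ * u i) ^ 2 / (2 * τ) = g i ^ 2 / (2 * τ) + τ / 2 * u i ^ 2 - u i * g i := by
      field_simp
      ring
    linarith
  rwa [Finset.sum_add_distrib, ← Finset.mul_sum, hu, mul_one, ← Finset.sum_div] at h

lemma sum_mul_le_one {M : Type*} [Fintype M] {f g : M → ℝ} (hf : ∑ i, f i ^ 2 = 1)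
    (hg : ∑ i, g i ^ 2 = 1) : ∑ i, f i * g i ≤ 1 := by
  have := sum_mul_le_of_sum_sq_eq_one hf g one_pos
  rw [hg] at this
  linarith

variable {M N K : Type*} [Fintype M] [Fintype N] [Fintype K] [Nonempty M] [Nonempty N] [Nonempty K]

lemma integral_sumExpLin_chevet_le {u : K → M → ℝ} {v : K → N → ℝ} (hu : ∀ k, ∑ i, u k i ^ 2 = 1)
    (hv : ∀ k, ∑ j, v k j ^ 2 = 1) {p b : ℝ} (hp : 0 ≤ p) (hp1 : p ≤ 1) (hb : 0 ≤ b) :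
    ∫ x, sumExpLin (Sum.elim (0 : M × N → K → ℝ)
        (Sum.elim (fun i k => b * u k i) fun j k => b * v k j)) x ^ p
        ∂(piStdGaussian ((M × N) ⊕ (M ⊕ N))) ≤
      Fintype.card K ^ p *
        Real.exp (p * b * (√(Fintype.card M) + √(Fintype.card N)) + (p * b) ^ 2) := by
  set l := p * b with hl_def
  have hl : 0 ≤ l := mul_nonneg hp hb
  set qm := √(Fintype.card M : ℝ)
  set qn := √(Fintype.card N : ℝ)
  have hqm : 0 < qm := Real.sqrt_pos.2 (by exact_mod_cast Fintype.card_pos)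
  have hqn : 0 < qn := Real.sqrt_pos.2 (by exact_mod_cast Fintype.card_pos)
  have hqm2 : (Fintype.card M : ℝ) = qm ^ 2 := (Real.sq_sqrt (Nat.cast_nonneg _)).symm
  have hqn2 : (Fintype.card N : ℝ) = qn ^ 2 := (Real.sq_sqrt (Nat.cast_nonneg _)).symm
  let w : (M × N) ⊕ (M ⊕ N) → ℝ := Sum.elim (fun _ => 0)
    (Sum.elim (fun _ => l / (2 * (qm + l))) (fun _ => l / (2 * (qn + l))))
  have hw (i) : w i < 1 / 2 := by
    rcases i with i | i | i
    · norm_num [w]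
    all_goals
      simp only [w, Sum.elim_inl, Sum.elim_inr]
      rw [div_lt_div_iff₀] <;> linarith
  let R : ((M × N) ⊕ (M ⊕ N) → ℝ) → ℝ := fun x => ∏ i, Real.exp (w i * x i ^ 2)
  have hR : Integrable R (piStdGaussian _) :=
    Integrable.fintype_prod (f := fun i (t : ℝ) => Real.exp (w i * t ^ 2))
      fun i => (integrable_exp_mul_sq_gaussianReal (hw i)).1
  have hRint : ∫ x, R x ∂(piStdGaussian _) ≤ Real.exp (l * qm / 2 + l * qn / 2) := by
    rw [integral_fintype_prod_eq_prod (f := fun i (t : ℝ) => Real.exp (w i * t ^ 2)),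
      Fintype.prod_sum_type, Fintype.prod_sum_type]
    simp only [w, Sum.elim_inl, Sum.elim_inr, zero_mul, Real.exp_zero, integral_const,
      probReal_univ, one_smul, Finset.prod_const, Finset.card_univ, one_pow, one_mul, Real.exp_add]
    refine mul_le_mul ?_ ?_ (by positivity) (by positivity)
    · refine (pow_le_pow_left₀ (by positivity)
        (integral_exp_mul_sq_gaussianReal_le hqm hl) _).trans_eq ?_
      rw [← Real.exp_nat_mul, hqm2]
      field_simp
    · refine (pow_le_pow_left₀ (by positivity)
        (integral_exp_mul_sq_gaussianReal_le hqn hl) _).trans_eq ?_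
      rw [← Real.exp_nat_mul, hqn2]
      field_simp
  have hpt (x) : sumExpLin (Sum.elim (0 : M × N → K → ℝ)
        (Sum.elim (fun i k => b * u k i) fun j k => b * v k j)) x ^ p ≤
      Fintype.card K ^ p * Real.exp (l * (qm + l) / 2 + l * (qn + l) / 2) * R x := by
    let P := (∑ i, x (.inr (.inl i)) ^ 2) / (2 * (qm + l)) + (qm + l) / 2 +
      ((∑ j, x (.inr (.inr j)) ^ 2) / (2 * (qn + l)) + (qn + l) / 2)
    have hk (k) : expLin (Sum.elim (0 : M × N → K → ℝ)
        (Sum.elim (fun i k => b * u k i) fun j k => b * v k j)) x k ≤ Real.exp (b * P) := by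
      refine Real.exp_le_exp.2 ?_
      simp only [Fintype.sum_sum_type, Sum.elim_inl, Sum.elim_inr, Pi.zero_apply, zero_mul,
        Finset.sum_const_zero, zero_add, mul_assoc, ← Finset.mul_sum, ← mul_add]
      exact mul_le_mul_of_nonneg_left (add_le_add
        (sum_mul_le_of_sum_sq_eq_one (hu k) _ (add_pos_of_pos_of_nonneg hqm hl))
        (sum_mul_le_of_sum_sq_eq_one (hv k) _ (add_pos_of_pos_of_nonneg hqn hl))) hb
    have hsum : sumExpLin (Sum.elim (0 : M × N → K → ℝ)
        (Sum.elim (fun i k => b * u k i) fun j k => b * v k j)) x ≤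
        Fintype.card K * Real.exp (b * P) := by
      simpa [sumExpLin] using Finset.sum_le_card_nsmul Finset.univ _ _ fun k _ => hk k
    refine (Real.rpow_le_rpow (sumExpLin_pos _ x).le hsum hp).trans_eq ?_
    rw [Real.mul_rpow (Nat.cast_nonneg _) (Real.exp_pos _).le, ← Real.exp_mul,
      mul_assoc ((Fintype.card K : ℝ) ^ p)]
    congr 1
    simp only [R, ← Real.exp_sum, ← Real.exp_add, Fintype.sum_sum_type, w, Sum.elim_inl,
      Sum.elim_inr, zero_mul, Finset.sum_const_zero, ← Finset.mul_sum]
    congr 1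
    simp only [P, hl_def]
    ring
  calc _ ≤ ∫ x, Fintype.card K ^ p * Real.exp (l * (qm + l) / 2 + l * (qn + l) / 2) * R x
        ∂(piStdGaussian _) :=
        integral_mono (integrable_sumExpLin_rpow _ hp hp1) (hR.const_mul _) hpt
    _ ≤ Fintype.card K ^ p * Real.exp (l * (qm + l) / 2 + l * (qn + l) / 2) *
        Real.exp (l * qm / 2 + l * qn / 2) := by
        rw [integral_const_mul]
        gcongr
    _ = _ := by
        rw [mul_assoc, ← Real.exp_add]
        ring_nf

/-- **The Chevet inequality**, in the form of a tail bound for finitely many values of the bilinear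
form of a Gaussian matrix on unit vectors. -/
lemma measureReal_exists_lt_bilin_le {u : K → M → ℝ} {v : K → N → ℝ}
    (hu : ∀ k, ∑ i, u k i ^ 2 = 1) (hv : ∀ k, ∑ j, v k j ^ 2 = 1) {t : ℝ} (ht : 0 ≤ t) :
    (piStdGaussian ((M × N) ⊕ (M ⊕ N))).real
      {x | ∃ k, √(Fintype.card M) + √(Fintype.card N) + t <
        ∑ q : M × N, u k q.1 * v k q.2 * x (.inl q)} ≤ 2 * Real.exp (-t ^ 2 / 2) := by
  have hK : 0 < (Fintype.card K : ℝ) := by exact_mod_cast Fintype.card_pos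
  have hK1 : 1 ≤ (Fintype.card K : ℝ) := by exact_mod_cast Fintype.card_pos
  set p : ℝ := (Fintype.card K : ℝ)⁻¹
  set b : ℝ := t * Fintype.card K
  have hp : 0 < p := inv_pos.2 hK
  have hp1 : p ≤ 1 := inv_le_one_of_one_le₀ hK1
  have hb : 0 ≤ b := by positivity
  have hpb : p * b = t := by simp only [p, b]; field_simp
  have hcard : (Fintype.card K : ℝ) ^ p ≤ 2 := by
    refine (Real.rpow_le_rpow hK.le ?_ hp.le).trans_eq
      (Real.pow_rpow_inv_natCast zero_le_two Fintype.card_ne_zero)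
    exact_mod_cast Nat.lt_two_pow_self.le
  let z : M × N → K → ℝ := fun q k => b * (u k q.1 * v k q.2)
  let y : M ⊕ N → K → ℝ := Sum.elim (fun i k => b * u k i) fun j k => b * v k j
  have hz (j k) : ∑ q, z q j * z q k = b ^ 2 * ((∑ i, u j i * u k i) * ∑ i, v j i * v k i) := by
    rw [Finset.sum_mul_sum, ← Finset.sum_product', Finset.mul_sum, Finset.univ_product_univ]
    exact Finset.sum_congr rfl fun q _ => by simp only [z]; ring
  have hy (j k) : ∑ q, y q j * y q k = b ^ 2 * (∑ i, u j i * u k i + ∑ i, v j i * v k i) := by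
    simp only [Fintype.sum_sum_type, mul_add, Finset.mul_sum, y, Sum.elim_inl, Sum.elim_inr]
    congr 1 <;> exact Finset.sum_congr rfl fun q _ => by ring
  have hslep := exp_mul_integral_sumExpLin_rpow_le z y (κ := b ^ 2) hp.le hp1
    (fun k => by
      simp only [sq (z _ k), sq (y _ k), hz, hy]
      simp only [← sq, hu, hv]
      ring)
    (fun j k => by
      rw [hz, hy]
      nlinarith [mul_nonneg (sq_nonneg b)
        (mul_nonneg (sub_nonneg.2 (sum_mul_le_one (hu j) (hu k)))
          (sub_nonneg.2 (sum_mul_le_one (hv j) (hv k))))])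
  have hY := integral_sumExpLin_chevet_le hu hv hp.le hp1 hb
  set τ := √(Fintype.card M) + √(Fintype.card N)
  rw [hpb] at hY
  rw [← mul_pow, hpb] at hslep
  let F : ((M × N) ⊕ (M ⊕ N) → ℝ) → ℝ := fun x => sumExpLin (Sum.elim z 0) x ^ p
  have hmarkov := mul_meas_ge_le_integral_of_nonneg (μ := piStdGaussian ((M × N) ⊕ (M ⊕ N)))
    (f := F) (.of_forall fun x => (Real.rpow_pos_of_pos (sumExpLin_pos _ x) _).le)
    (integrable_sumExpLin_rpow _ hp.le hp1) (Real.exp (t * (τ + t)))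
  have hsub : {x : (M × N) ⊕ (M ⊕ N) → ℝ | ∃ k, τ + t <
      ∑ q : M × N, u k q.1 * v k q.2 * x (.inl q)} ⊆ {x | Real.exp (t * (τ + t)) ≤ F x} := by
    rintro x ⟨k, hk⟩
    have h1 : Real.exp (b * (τ + t)) ≤ sumExpLin (Sum.elim z 0) x := by
      refine le_trans (Real.exp_le_exp.2 ?_) (expLin_le_sumExpLin _ x k)
      simp only [Fintype.sum_sum_type, Sum.elim_inl, Sum.elim_inr, Pi.zero_apply, zero_mul,
        Finset.sum_const_zero, add_zero, z, mul_assoc, ← Finset.mul_sum]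
      simp only [← mul_assoc]
      gcongr
    have h2 := Real.rpow_le_rpow (Real.exp_pos _).le h1 hp.le
    rwa [← Real.exp_mul, mul_right_comm, mul_comm b p, hpb] at h2
  have hm := measureReal_mono (μ := piStdGaussian ((M × N) ⊕ (M ⊕ N))) hsub
  have hfin : Real.exp (t ^ 2 / 2) * (Real.exp (t * (τ + t)) *
      (piStdGaussian ((M × N) ⊕ (M ⊕ N))).real {x | ∃ k, τ + t <
      ∑ q : M × N, u k q.1 * v k q.2 * x (.inl q)}) ≤ 2 * Real.exp (t * τ + t ^ 2) := by
    calc _ ≤ Real.exp (t ^ 2 / 2) * ∫ x, F x ∂(piStdGaussian _) := by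
          gcongr
          exact le_trans (by gcongr) hmarkov
      _ ≤ _ := hslep.trans (hY.trans (by gcongr))
  rw [← mul_assoc, ← Real.exp_add] at hfin
  rw [← le_div_iff₀' (Real.exp_pos _)] at hfin
  refine hfin.trans_eq ?_
  rw [mul_div_assoc, ← Real.exp_sub]
  ring_nf

lemma sum_sq_eq_one_of_mem_sphere {L : Type*} [Fintype L]
    (w : Metric.sphere (0 : EuclideanSpace ℝ L) 1) : ∑ i, w.1 i ^ 2 = 1 := by
  rw [← EuclideanSpace.real_norm_sq_eq, norm_eq_of_mem_sphere w, one_pow]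

instance nonempty_unit_sphere {L : Type*} [Fintype L] [Nonempty L] :
    Nonempty (Metric.sphere (0 : EuclideanSpace ℝ L) 1) := by
  classical
  exact ⟨EuclideanSpace.single (Classical.arbitrary L) 1, by simp⟩

/-- **The Chevet inequality**: tail bound for the operator norm of a Gaussian matrix. -/
lemma measure_exists_unit_lt_bilin_le {t : ℝ} (ht : 0 ≤ t) :
    piStdGaussian ((M × N) ⊕ (M ⊕ N))
      {x | ∃ (u : M → ℝ) (v : N → ℝ), ∑ i, u i ^ 2 = 1 ∧ ∑ j, v j ^ 2 = 1 ∧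
        √(Fintype.card M) + √(Fintype.card N) + t <
        ∑ q : M × N, u q.1 * v q.2 * x (.inl q)} ≤ ENNReal.ofReal (2 * Real.exp (-t ^ 2 / 2)) := by
  let bil : Metric.sphere (0 : EuclideanSpace ℝ M) 1 × Metric.sphere (0 : EuclideanSpace ℝ N) 1 →
      ((M × N) ⊕ (M ⊕ N) → ℝ) → ℝ := fun s x => ∑ q : M × N, s.1.1 q.1 * s.2.1 q.2 * x (.inl q)
  have hbil (x) : Continuous fun s => bil s x := by
    simp only [bil]
    fun_prop
  set τ := √(Fintype.card M) + √(Fintype.card N) + t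
  obtain ⟨d, hd⟩ := TopologicalSpace.exists_dense_seq
    (Metric.sphere (0 : EuclideanSpace ℝ M) 1 × Metric.sphere (0 : EuclideanSpace ℝ N) 1)
  let f : ℕ → Set ((M × N) ⊕ (M ⊕ N) → ℝ) := fun k => {x | τ < bil (d k) x}
  have hcover : {x | ∃ (u : M → ℝ) (v : N → ℝ), ∑ i, u i ^ 2 = 1 ∧ ∑ j, v j ^ 2 = 1 ∧
      τ < ∑ q : M × N, u q.1 * v q.2 * x (.inl q)} ⊆ ⋃ k, f k := by
    rintro x ⟨u, v, hu, hv, h⟩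
    have hu' : WithLp.toLp 2 u ∈ Metric.sphere (0 : EuclideanSpace ℝ M) 1 := by
      simp [EuclideanSpace.norm_eq, hu]
    have hv' : WithLp.toLp 2 v ∈ Metric.sphere (0 : EuclideanSpace ℝ N) 1 := by
      simp [EuclideanSpace.norm_eq, hv]
    obtain ⟨k, hk⟩ := hd.exists_mem_open (isOpen_lt continuous_const (hbil x))
      ⟨(⟨_, hu'⟩, ⟨_, hv'⟩), h⟩
    exact Set.mem_iUnion.2 ⟨k, hk⟩
  refine (measure_mono hcover).trans (le_of_tendsto' tendsto_measure_iUnion_accumulate fun k => ?_)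
  have hacc : Set.accumulate f k ⊆ {x | ∃ l : Fin (k + 1), τ < bil (d l) x} := by
    intro x hx
    obtain ⟨l, hl, hx⟩ := Set.mem_accumulate.1 hx
    exact ⟨⟨l, by lia⟩, hx⟩
  refine (measure_mono hacc).trans ?_
  rw [← ofReal_measureReal]
  exact ENNReal.ofReal_le_ofReal (measureReal_exists_lt_bilin_le
    (u := fun l : Fin (k + 1) => (d l).1.1) (v := fun l : Fin (k + 1) => (d l).2.1)
    (fun l => sum_sq_eq_one_of_mem_sphere _) (fun l => sum_sq_eq_one_of_mem_sphere _) ht)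

end OperatorNorm

section RandomMatrix

lemma measurePreserving_curry_piStdGaussian {M N : Type*} [Fintype M] [Fintype N] :
    MeasurePreserving (fun (x : M × N → ℝ) i j => x (i, j)) (piStdGaussian (M × N))
      (Measure.pi fun _ => piStdGaussian N) := by
  refine ⟨by fun_prop, ?_⟩
  have h := Measure.infinitePi_map_curry (fun (_ : M) (_ : N) => gaussianReal 0 1)
  simp only [Measure.infinitePi_eq_pi] at h
  exact h

/-- A Gaussian matrix with entries of variance `1 / n` is a rescaled standard Gaussian one. -/
lemma measurePreserving_gaussianMatrix (m n : ℕ) :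
    MeasurePreserving
      (fun (x : (Fin m × Fin n) ⊕ (Fin m ⊕ Fin n) → ℝ) i j => (√n)⁻¹ * x (.inl (i, j)))
      (piStdGaussian ((Fin m × Fin n) ⊕ (Fin m ⊕ Fin n)))
      (Measure.pi fun _ : Fin m => gaussianVec n (1 / (n : NNReal))) := by
  have hscale : MeasurePreserving (fun x : ℝ => (√n)⁻¹ * x) (gaussianReal 0 1)
      (gaussianReal 0 (1 / (n : NNReal))) := by
    refine ⟨by fun_prop, ?_⟩
    rw [gaussianReal_map_const_mul]
    congr 1
    · simp
    · ext
      simp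
  have h₁ : MeasurePreserving (fun (x : (Fin m × Fin n) ⊕ (Fin m ⊕ Fin n) → ℝ) q => x (.inl q))
      (piStdGaussian _) (piStdGaussian _) :=
    measurePreserving_fst.comp (measurePreserving_sumPiEquivProdPi fun _ => gaussianReal 0 1)
  exact (measurePreserving_pi _ _ fun _ => measurePreserving_pi _ _ fun _ => hscale).comp
    (measurePreserving_curry_piStdGaussian.comp h₁)

lemma vnorm_nonneg {k : ℕ} (v : Fin k → ℝ) : 0 ≤ vnorm v := Real.sqrt_nonneg _

lemma sq_vnorm {k : ℕ} (v : Fin k → ℝ) : vnorm v ^ 2 = ∑ i, v i ^ 2 :=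
  Real.sq_sqrt (Finset.sum_nonneg fun _ _ => sq_nonneg _)

lemma sq_fnorm {n r : ℕ} (B : Matrix (Fin n) (Fin r) ℝ) :
    fnorm B ^ 2 = ∑ c, vnorm (B.col c) ^ 2 := by
  have h : (Bᵀ * B).trace = ∑ c, vnorm (B.col c) ^ 2 := by
    simp [Matrix.trace, Matrix.mul_apply, sq_vnorm, ← sq]
  rw [fnorm, h, Real.sq_sqrt (Finset.sum_nonneg fun _ _ => sq_nonneg _)]

lemma sum_sq_normalize {k : ℕ} {v : Fin k → ℝ} (hv : vnorm v ≠ 0) :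
    ∑ i, ((vnorm v)⁻¹ * v i) ^ 2 = 1 := by
  simp only [mul_pow, ← Finset.mul_sum, ← sq_vnorm]
  rw [← mul_pow, inv_mul_cancel₀ hv, one_pow]

/-- A bound for the bilinear form of a matrix on unit vectors bounds its operator norm. -/
lemma vnorm_mulVec_le {m n : ℕ} {A : Matrix (Fin m) (Fin n) ℝ} {C : ℝ} (hC : 0 ≤ C)
    (h : ∀ (u : Fin m → ℝ) (v : Fin n → ℝ), ∑ i, u i ^ 2 = 1 → ∑ j, v j ^ 2 = 1 →
      u ⬝ᵥ A *ᵥ v ≤ C) (w : Fin n → ℝ) : vnorm (A *ᵥ w) ≤ C * vnorm w := by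
  rcases (vnorm_nonneg (A *ᵥ w)).eq_or_lt' with h0 | hA
  · rw [h0]
    exact mul_nonneg hC (vnorm_nonneg w)
  have hw : 0 < vnorm w := by
    refine (vnorm_nonneg w).lt_of_ne' fun h0 => hA.ne' ?_
    have hz : w = 0 := by
      have := sq_vnorm w
      rw [h0, eq_comm, zero_pow two_ne_zero,
        Finset.sum_eq_zero_iff_of_nonneg fun _ _ => sq_nonneg _] at this
      ext i
      simpa using this i (Finset.mem_univ i)
    simp [hz, vnorm]
  have key := h ((vnorm (A *ᵥ w))⁻¹ • (A *ᵥ w)) ((vnorm w)⁻¹ • w)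
    (sum_sq_normalize hA.ne') (sum_sq_normalize hw.ne')
  have hself : (A *ᵥ w) ⬝ᵥ (A *ᵥ w) = vnorm (A *ᵥ w) ^ 2 := by
    simp [sq_vnorm, dotProduct, ← sq]
  rw [Matrix.mulVec_smul, dotProduct_smul, smul_dotProduct, hself, smul_eq_mul, smul_eq_mul] at key
  rwa [sq, inv_mul_cancel_left₀ hA.ne', inv_mul_le_iff₀ hw, mul_comm] at key

lemma sum_vnorm_transpose_mulVec_le {m n r : ℕ} {A : Matrix (Fin m) (Fin n) ℝ} {C : ℝ} (hC : 0 ≤ C)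
    (h : ∀ w, vnorm (A *ᵥ w) ≤ C * vnorm w) (B : Matrix (Fin n) (Fin r) ℝ) :
    ∑ i, vnorm (Bᵀ *ᵥ A i) ≤ √m * (C * fnorm B) := by
  have hsum : ∑ i, vnorm (Bᵀ *ᵥ A i) ^ 2 = ∑ c, vnorm (A *ᵥ B.col c) ^ 2 := by
    simp only [sq_vnorm]
    rw [Finset.sum_comm]
    simp [Matrix.mulVec, dotProduct, mul_comm]
  have hF : 0 ≤ fnorm B := Real.sqrt_nonneg _
  refine abs_le_of_sq_le_sq' ?_ (by positivity) |>.2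
  calc (∑ i, vnorm (Bᵀ *ᵥ A i)) ^ 2 ≤ m * ∑ i, vnorm (Bᵀ *ᵥ A i) ^ 2 := by
        simpa using sq_sum_le_card_mul_sum_sq (s := Finset.univ)
          (f := fun i => vnorm (Bᵀ *ᵥ A i))
    _ ≤ m * ∑ c, (C * vnorm (B.col c)) ^ 2 := by
        rw [hsum]
        gcongr with c
        · exact vnorm_nonneg _
        · exact h _
    _ = _ := by
        simp only [mul_pow, ← Finset.mul_sum, ← sq_fnorm]
        rw [Real.sq_sqrt m.cast_nonneg]

end RandomMatrix

/-- Haystack model, outlier bound. With independent outliers oᵢ ~ N(0,(1/n)Iₙ),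
c_{O,max} ≤ 1/√n + √(8r/m₂) + c₂/√m₂ with probability at least 1 − 2exp(−c₂²n/2). -/
theorem haystack_outlier_bound (n r m₂ : ℕ) (hn : 1 ≤ n) (hr : 1 ≤ r) (hm₂ : 1 ≤ m₂)
    (c₂ : ℝ) (hc₂ : 0 < c₂) :
    ENNReal.ofReal (1 - 2 * Real.exp (-(c₂ ^ 2 * (n : ℝ)) / 2)) ≤
      (Measure.pi fun _ : Fin m₂ => gaussianVec n (1 / (n : NNReal)))
        {ω | (1 / (m₂ : ℝ)) * sSup {t | ∃ B : Matrix (Fin n) (Fin r) ℝ,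
                fnorm B = 1 ∧ t = ∑ i, vnorm (Bᵀ *ᵥ ω i)}
              ≤ 1 / Real.sqrt (n : ℝ) + Real.sqrt (8 * (r : ℝ) / (m₂ : ℝ))
                + c₂ / Real.sqrt (m₂ : ℝ)} := by
  have : Nonempty (Fin n) := ⟨⟨0, hn⟩⟩
  have : Nonempty (Fin m₂) := ⟨⟨0, hm₂⟩⟩
  have hn' : 0 < √(n : ℝ) := Real.sqrt_pos.2 (by exact_mod_cast hn)
  have hm' : 0 < √(m₂ : ℝ) := Real.sqrt_pos.2 (by exact_mod_cast hm₂)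
  have hT := measurePreserving_gaussianMatrix m₂ n
  have htail := measure_exists_unit_lt_bilin_le (M := Fin m₂) (N := Fin n) (t := c₂ * √n)
    (by positivity)
  rw [mul_pow, Real.sq_sqrt n.cast_nonneg] at htail
  simp only [Fintype.card_fin] at htail
  set E := {x : (Fin m₂ × Fin n) ⊕ (Fin m₂ ⊕ Fin n) → ℝ | ∃ (u : Fin m₂ → ℝ) (v : Fin n → ℝ),
    ∑ i, u i ^ 2 = 1 ∧ ∑ j, v j ^ 2 = 1 ∧ √m₂ + √n + c₂ * √n <
      ∑ q : Fin m₂ × Fin n, u q.1 * v q.2 * x (.inl q)}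
  rw [← hT.map_eq]
  refine le_trans ?_ (Measure.le_map_apply hT.aemeasurable _)
  refine le_trans (b := piStdGaussian ((Fin m₂ × Fin n) ⊕ (Fin m₂ ⊕ Fin n)) Eᶜ) ?_
    (measure_mono fun x hx => ?_)
  · rw [ENNReal.ofReal_sub _ (by positivity), ENNReal.ofReal_one, tsub_le_iff_left]
    calc (1 : ENNReal) = piStdGaussian ((Fin m₂ × Fin n) ⊕ (Fin m₂ ⊕ Fin n)) (E ∪ Eᶜ) := by simp
      _ ≤ _ := (measure_union_le _ _).trans (by gcongr)
  · set ω : Matrix (Fin m₂) (Fin n) ℝ := fun i j => (√n)⁻¹ * x (.inl (i, j))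
    have hop := vnorm_mulVec_le (A := ω) (C := (√n)⁻¹ * (√m₂ + √n + c₂ * √n)) (by positivity)
      fun u v hu hv => by
        have hle : ∑ q : Fin m₂ × Fin n, u q.1 * v q.2 * x (.inl q) ≤ √m₂ + √n + c₂ * √n :=
          not_lt.1 fun hlt => hx ⟨u, v, hu, hv, hlt⟩
        calc u ⬝ᵥ ω *ᵥ v = (√n)⁻¹ * ∑ q : Fin m₂ × Fin n, u q.1 * v q.2 * x (.inl q) := by
              simp only [dotProduct, Matrix.mulVec, Fintype.sum_prod_type, Finset.mul_sum, ω]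
              exact Finset.sum_congr rfl fun _ _ => Finset.sum_congr rfl fun _ _ => by ring
          _ ≤ _ := by gcongr
    have hsup : sSup {t | ∃ B : Matrix (Fin n) (Fin r) ℝ,
        fnorm B = 1 ∧ t = ∑ i, vnorm (Bᵀ *ᵥ ω i)} ≤
        √m₂ * ((√n)⁻¹ * (√m₂ + √n + c₂ * √n)) := by
      refine Real.sSup_le ?_ (by positivity)
      rintro _ ⟨B, hB, rfl⟩
      simpa only [hB, mul_one] using sum_vnorm_transpose_mulVec_le (by positivity) hop B
    calc 1 / (m₂ : ℝ) * sSup {t | ∃ B : Matrix (Fin n) (Fin r) ℝ,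
          fnorm B = 1 ∧ t = ∑ i, vnorm (Bᵀ *ᵥ ω i)}
        ≤ 1 / (m₂ : ℝ) * (√m₂ * ((√n)⁻¹ * (√m₂ + √n + c₂ * √n))) := by gcongr
      _ = 1 / √n + √(1 / m₂) + c₂ / √m₂ := by
          rw [Real.sqrt_div zero_le_one, Real.sqrt_one]
          nth_rewrite 1 [← Real.sq_sqrt m₂.cast_nonneg]
          field_simp
      _ ≤ _ := by
          gcongr
          have : (1 : ℝ) ≤ r := by exact_mod_cast hr
          linarith

end
end

section
/- Let y be a random vector in ℝ^d with independent Gaussian coordinates of mean 0 and variance 1/d (i.e., y ~ N(0, (1/d)I_d)). Then for every ℓ ≥ 1 and every matrix D ∈ ℝ^{d×ℓ} with ‖D‖_F = 1, the expectation E[‖Dᵀy‖₂] ≥ √(2/(dπ)). Moreover, equality is attained when all columns of D are equal, so inf{ E[‖Dᵀy‖₂] : D ∈ ℝ^{d×ℓ}, ‖D‖_F = 1 } = √(2/(dπ)). -/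
open Matrix MeasureTheory ProbabilityTheory

noncomputable section

/-- The first absolute moment of a centred real Gaussian. -/
lemma integral_abs_gaussianReal (v : NNReal) :
    ∫ x, |x| ∂(gaussianReal 0 v) = Real.sqrt (2 * v / Real.pi) := by
  rcases eq_or_ne v 0 with rfl | hv
  · simp
  have hv' : (0 : ℝ) < v := by exact_mod_cast pos_iff_ne_zero.mpr hv
  have half_line : ∫ x in Set.Ioi (0 : ℝ), x * Real.exp (-(2 * (v : ℝ))⁻¹ * x ^ 2) = v := by
    have h := integral_rpow_mul_exp_neg_mul_rpow (p := 2) (q := 1) (b := (2 * (v : ℝ))⁻¹)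
      two_pos (by norm_num) (by positivity)
    have exponent : -((1 : ℝ) + 1) / 2 = -1 := by norm_num
    have gamma_arg : ((1 : ℝ) + 1) / 2 = 1 := by norm_num
    simp only [exponent, gamma_arg, Real.rpow_neg_one, Real.rpow_one, Real.rpow_two, inv_inv,
      Real.Gamma_one] at h
    rw [h]
    ring
  rw [integral_gaussianReal_eq_integral_smul hv]
  calc ∫ x, gaussianPDFReal 0 v x • |x|
      = ∫ x, (fun t => (Real.sqrt (2 * Real.pi * v))⁻¹ *
          (t * Real.exp (-(2 * (v : ℝ))⁻¹ * t ^ 2))) |x| := by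
        congr 1 with x
        simp only [gaussianPDFReal, sub_zero, sq_abs, smul_eq_mul]
        rw [show -x ^ 2 / (2 * (v : ℝ)) = -(2 * (v : ℝ))⁻¹ * x ^ 2 by ring]
        ring
    _ = 2 * ((Real.sqrt (2 * Real.pi * v))⁻¹ * v) := by
        rw [integral_comp_abs (f := fun t => (Real.sqrt (2 * Real.pi * v))⁻¹ *
          (t * Real.exp (-(2 * (v : ℝ))⁻¹ * t ^ 2))), integral_const_mul, half_line]
    _ = Real.sqrt (2 * v / Real.pi) := by
        symm
        rw [Real.sqrt_eq_iff_mul_self_eq (by positivity) (by positivity)]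
        have h := Real.mul_self_sqrt (show 0 ≤ 2 * Real.pi * (v : ℝ) by positivity)
        generalize Real.sqrt (2 * Real.pi * v) = s at h ⊢
        rw [show 2 * (s⁻¹ * v) * (2 * (s⁻¹ * v)) = 4 * (v : ℝ) ^ 2 * (s * s)⁻¹ by
          rw [mul_inv]; ring, h]
        field_simp
        norm_num

instance isProbabilityMeasure_gaussianVec (k : ℕ) (v : NNReal) :
    IsProbabilityMeasure (gaussianVec k v) := by
  unfold gaussianVec
  infer_instance

lemma measurable_dotProduct_left {k : ℕ} (a : Fin k → ℝ) :
    Measurable fun y : Fin k → ℝ => a ⬝ᵥ y := by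
  unfold dotProduct
  fun_prop

/-- A linear form of an isotropic centred Gaussian vector is a centred real Gaussian. -/
lemma gaussianVec_map_dotProduct {k : ℕ} (v : NNReal) (a : Fin k → ℝ) :
    (gaussianVec k v).map (fun y => a ⬝ᵥ y) =
      gaussianReal 0 ((∑ i, a i ^ 2).toNNReal * v) := by
  have marginal (i : Fin k) : (gaussianVec k v).map (fun y => a i * y i) =
      gaussianReal 0 (.mk (a i ^ 2) (sq_nonneg _) * v) := by
    have h := gaussianReal_map_const_mul (μ := 0) (v := v) (a i)
    rw [mul_zero] at h
    rw [← h, ← (measurePreserving_eval (fun _ : Fin k => gaussianReal 0 v) i).map_eq,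
      Measure.map_map (by fun_prop) (by fun_prop)]
    rfl
  have indep : iIndepFun (fun i (y : Fin k → ℝ) => a i * y i) (gaussianVec k v) :=
    iIndepFun_pi (X := fun i x => a i * x) fun i => by fun_prop
  have : IsProbabilityMeasure ((gaussianVec k v).map fun y => a ⬝ᵥ y) :=
    Measure.isProbabilityMeasure_map (measurable_dotProduct_left a).aemeasurable
  refine Measure.ext_of_charFun ?_
  ext t
  simp only [dotProduct]
  rw [indep.charFun_map_fun_sum_eq_prod fun i =>
    ((measurable_pi_apply i).const_mul (a i)).aemeasurable]
  simp only [Finset.prod_apply, marginal, charFun_gaussianReal]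
  rw [← Complex.exp_sum]
  congr 1
  simp [Real.coe_toNNReal _ (Finset.sum_nonneg fun i _ => sq_nonneg (a i)),
    Finset.sum_mul, Finset.sum_div]

/-- The first absolute moment of a linear form of an isotropic centred Gaussian vector. -/
lemma integral_abs_dotProduct_gaussianVec {k : ℕ} (v : NNReal) (a : Fin k → ℝ) :
    ∫ y, |a ⬝ᵥ y| ∂(gaussianVec k v) = vnorm a * Real.sqrt (2 * v / Real.pi) := by
  have ha : 0 ≤ ∑ i, a i ^ 2 := Finset.sum_nonneg fun i _ => sq_nonneg (a i)
  rw [← integral_map (f := fun x : ℝ => |x|) (measurable_dotProduct_left a).aemeasurable (by fun_prop),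
    gaussianVec_map_dotProduct, integral_abs_gaussianReal, vnorm, ← Real.sqrt_mul ha]
  congr 1
  rw [NNReal.coe_mul, Real.coe_toNNReal _ ha]
  ring

lemma integrable_abs_dotProduct_gaussianVec {k : ℕ} (v : NNReal) (a : Fin k → ℝ) :
    Integrable (fun y => |a ⬝ᵥ y|) (gaussianVec k v) := by
  have h : Integrable id ((gaussianVec k v).map fun y => a ⬝ᵥ y) := by
    rw [gaussianVec_map_dotProduct]
    exact (memLp_id_gaussianReal 1).integrable le_rfl
  exact (h.comp_measurable (measurable_dotProduct_left a)).abs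

lemma vnorm_le_sum_abs {k : ℕ} (w : Fin k → ℝ) : vnorm w ≤ ∑ i, |w i| := by
  refine Real.sqrt_le_iff.mpr ⟨Finset.sum_nonneg fun i _ => abs_nonneg _, ?_⟩
  simpa only [sq_abs] using
    Finset.sum_sq_le_sq_sum_of_nonneg (s := Finset.univ) fun i _ => abs_nonneg (w i)

lemma integrable_vnorm_mulVec_gaussianVec {k r : ℕ} (v : NNReal) (A : Matrix (Fin r) (Fin k) ℝ) :
    Integrable (fun y => vnorm (A *ᵥ y)) (gaussianVec k v) := by
  refine (integrable_finsetSum Finset.univ fun j _ =>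
    integrable_abs_dotProduct_gaussianVec v (A j)).mono' ?_ (.of_forall fun y => ?_)
  · exact (Measurable.sqrt (Finset.measurable_sum _ fun j _ =>
      (measurable_dotProduct_left (A j)).pow_const 2)).aestronglyMeasurable
  · exact (Real.norm_of_nonneg (Real.sqrt_nonneg _)).trans_le (vnorm_le_sum_abs (A *ᵥ y))

lemma fnorm_eq_sqrt_sum_vnorm_sq {n r : ℕ} (A : Matrix (Fin n) (Fin r) ℝ) :
    fnorm A = Real.sqrt (∑ j, vnorm (Aᵀ j) ^ 2) := by
  unfold fnorm vnorm
  congr 1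
  refine Finset.sum_congr rfl fun j _ => ?_
  rw [Real.sq_sqrt (Finset.sum_nonneg fun i _ => sq_nonneg _)]
  simp [Matrix.mul_apply, sq]

lemma sum_mul_abs_le_vnorm {k : ℕ} {a : Fin k → ℝ} (ha : ∑ j, a j ^ 2 = 1) (w : Fin k → ℝ) :
    ∑ j, a j * |w j| ≤ vnorm w := by
  refine Real.le_sqrt_of_sq_le ?_
  simpa [ha] using Finset.sum_mul_sq_le_sq_mul_sq Finset.univ a fun j => |w j|

lemma sqrt_le_integral_vnorm_gaussianVec {k r : ℕ} (v : NNReal) {D : Matrix (Fin k) (Fin r) ℝ}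
    (hD : fnorm D = 1) :
    Real.sqrt (2 * v / Real.pi) ≤ ∫ y, vnorm (Dᵀ *ᵥ y) ∂(gaussianVec k v) := by
  have hcol : ∑ j, vnorm (Dᵀ j) ^ 2 = 1 := by
    rwa [fnorm_eq_sqrt_sum_vnorm_sq, Real.sqrt_eq_one] at hD
  have hint (j : Fin r) :
      Integrable (fun y => vnorm (Dᵀ j) * |Dᵀ j ⬝ᵥ y|) (gaussianVec k v) :=
    (integrable_abs_dotProduct_gaussianVec v (Dᵀ j)).const_mul _
  calc Real.sqrt (2 * v / Real.pi)
      = ∑ j, vnorm (Dᵀ j) * (vnorm (Dᵀ j) * Real.sqrt (2 * v / Real.pi)) := by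
        simp_rw [← mul_assoc, ← sq]
        rw [← Finset.sum_mul, hcol, one_mul]
    _ = ∫ y, ∑ j, vnorm (Dᵀ j) * |Dᵀ j ⬝ᵥ y| ∂(gaussianVec k v) := by
        rw [integral_finsetSum _ fun j _ => hint j]
        simp_rw [integral_const_mul, integral_abs_dotProduct_gaussianVec]
    _ ≤ ∫ y, vnorm (Dᵀ *ᵥ y) ∂(gaussianVec k v) :=
        integral_mono (integrable_finsetSum _ fun j _ => hint j)
          (integrable_vnorm_mulVec_gaussianVec v Dᵀ)
          fun y => sum_mul_abs_le_vnorm hcol (Dᵀ *ᵥ y)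

lemma vnorm_single {k : ℕ} (i : Fin k) (x : ℝ) : vnorm (Pi.single i x) = |x| := by
  simp [vnorm, Pi.single_apply, ite_pow, Real.sqrt_sq_eq_abs]

lemma fnorm_single_one {n r : ℕ} (i : Fin n) (j : Fin r) :
    fnorm (Matrix.single i j (1 : ℝ)) = 1 := by
  simp [fnorm]

lemma integral_vnorm_single_gaussianVec {k r : ℕ} (v : NNReal) (i : Fin k) (j : Fin r) :
    ∫ y, vnorm ((Matrix.single i j (1 : ℝ))ᵀ *ᵥ y) ∂(gaussianVec k v) =
      Real.sqrt (2 * v / Real.pi) := by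
  have h (y : Fin k → ℝ) :
      vnorm ((Matrix.single i j (1 : ℝ))ᵀ *ᵥ y) = |Pi.single i (1 : ℝ) ⬝ᵥ y| := by
    rw [Matrix.transpose_single, single_dotProduct, ← vnorm_single j]
    congr 1
    ext l
    simp [Matrix.single_mulVec, Function.update_apply, Pi.single_apply]
  simp_rw [h, integral_abs_dotProduct_gaussianVec, vnorm_single, abs_one, one_mul]

/-- If y ~ N(0,(1/d)I_d), then for every D with ‖D‖_F = 1 one has
E[‖Dᵀy‖₂] ≥ √(2/(dπ)), with equality attained (so the infimum over the Frobenius unit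
sphere equals √(2/(dπ))). -/
theorem gaussian_image_expectation_lower (d ℓ : ℕ) (hd : 1 ≤ d) (hℓ : 1 ≤ ℓ) :
    (∀ D : Matrix (Fin d) (Fin ℓ) ℝ, fnorm D = 1 →
        Real.sqrt (2 / ((d : ℝ) * Real.pi)) ≤
          ∫ y, vnorm (Dᵀ *ᵥ y) ∂(gaussianVec d (1 / (d : NNReal)))) ∧
      sInf {t | ∃ D : Matrix (Fin d) (Fin ℓ) ℝ, fnorm D = 1 ∧
          t = ∫ y, vnorm (Dᵀ *ᵥ y) ∂(gaussianVec d (1 / (d : NNReal)))}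
        = Real.sqrt (2 / ((d : ℝ) * Real.pi)) := by
  have hconst : Real.sqrt (2 * ((1 / (d : NNReal) : NNReal) : ℝ) / Real.pi) =
      Real.sqrt (2 / ((d : ℝ) * Real.pi)) := by
    push_cast
    congr 1
    rw [mul_one_div, div_div]
  rw [← hconst]
  refine ⟨fun D hD => sqrt_le_integral_vnorm_gaussianVec _ hD, IsLeast.csInf_eq ⟨?_, ?_⟩⟩
  · exact ⟨Matrix.single ⟨0, hd⟩ ⟨0, hℓ⟩ 1, fnorm_single_one _ _,
      (integral_vnorm_single_gaussianVec _ _ _).symm⟩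
  · rintro t ⟨D, hD, rfl⟩
    exact sqrt_le_integral_vnorm_gaussianVec _ hD

end
end
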